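/- Assume the Riemann hypothesis. Then for every δ > 0 there exists T₀ > 0 such that for every real T ≥ T₀ there exists t ∈ [T, T+δ] with ζ(1/2 + it) = 0. In other words, under RH every interval of fixed positive length sufficiently high up on the critical line contains a zero of the Riemann zeta function. -/

import Mathlib

section Helpers

open Complex Metric Set Filter Topology

/-- three circles step -/
lemma zz_step (F : ℂ → ℂ) (c : ℂ) (r A κ : ℝ) (hr : 0 < r) (hA : 0 < A) (hκ : 0 < κ) (hκ1 : κ ≤ 1)
    (hd : DifferentiableOn ℂ F (ball c (4 * r)))
    (hre : ∀ z ∈ ball c (4 * r), (F z).re ≤ A)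
    (hs : ∀ z ∈ closedBall c r, ‖F z‖ ≤ κ) :
    ∀ z ∈ closedBall c (3 / 2 * r), ‖F z‖ ≤ κ ^ (1 / 2 : ℝ) * (6 * A + 7) := by
  have hbc : ∀ z ∈ closedBall c (3 * r), ‖F z‖ ≤ 6 * A + 7 := by
    intro z hz
    have hz' : ‖z - c‖ ≤ 3 * r := by simpa [dist_eq_norm] using hz
    have h := borelCaratheodory (M := A) (f := fun w => F (c + w)) (R := 4 * r) (z := z - c) hA
      (hd.comp (by fun_prop) (fun w hw => by simpa using hw))
      (fun w hw => hre _ (by simpa using hw)) (by positivity)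
      (by simp; linarith)
    have h0 : ‖F c‖ ≤ 1 := (hs c (by simp [hr.le])).trans hκ1
    simp only [add_sub_cancel, add_zero] at h
    refine h.trans ?_
    have hden : 0 < 4 * r - ‖z - c‖ := by linarith
    rw [← add_div, div_le_iff₀ hden]
    have : ‖F c‖ * (4 * r + ‖z - c‖) ≤ 1 * (4 * r + ‖z - c‖) := by gcongr
    nlinarith [norm_nonneg (z - c)]
  set M := 6 * A + 7 with hM
  have hM1 : 1 ≤ M := by linarith
  have hk1 : κ ≤ κ ^ (1 / 2 : ℝ) := by
    simpa using Real.rpow_le_rpow_of_exponent_ge hκ hκ1 (by norm_num : (1 / 2 : ℝ) ≤ 1)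
  have hk0 : 0 < κ ^ (1 / 2 : ℝ) := by positivity
  intro z hz
  by_cases hzr : ‖z - c‖ ≤ r
  · exact (hs z (by simpa [dist_eq_norm] using hzr)).trans (hk1.trans (by nlinarith))
  push Not at hzr
  have hz' : ‖z - c‖ ≤ 3 / 2 * r := by simpa [dist_eq_norm] using hz
  have hne : z - c ≠ 0 := by
    intro h; rw [h] at hzr; simp at hzr; linarith
  set w := Complex.log ((z - c) / r) with hw
  have hrC : (r : ℂ) ≠ 0 := by exact_mod_cast hr.ne'
  have hexp : c + r * Complex.exp w = z := by
    rw [hw, Complex.exp_log (div_ne_zero hne hrC)]; field_simp; ring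
  have hwre : w.re = Real.log (‖z - c‖ / r) := by
    rw [hw, Complex.log_re, norm_div, Complex.norm_real, Real.norm_of_nonneg hr.le]
  have hw0 : 0 ≤ w.re := by
    rw [hwre]; exact Real.log_nonneg ((one_le_div hr).2 hzr.le)
  have hw1 : w.re ≤ 1 / 2 := by
    rw [hwre, Real.log_le_iff_le_exp (div_pos (hr.trans hzr) hr)]
    have := Real.add_one_le_exp (1/2 : ℝ)
    rw [div_le_iff₀ hr]; nlinarith
  have hn : ∀ v : ℂ, v.re ≤ 1 → c + r * Complex.exp v ∈ closedBall c (3 * r) := by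
    intro v hv
    have : Real.exp v.re ≤ 3 := (Real.exp_le_exp.2 hv).trans (by linarith [Real.exp_one_lt_d9])
    simp [Complex.norm_exp, abs_of_pos hr]
    nlinarith
  have key := HadamardThreeLines.norm_le_interp_of_mem_verticalClosedStrip'
    (f := fun v => F (c + r * Complex.exp v)) (z := w) (a := κ) (b := M) (l := 0) (u := 1)
    (by norm_num) (by simp [HadamardThreeLines.verticalClosedStrip, hw0]; linarith)
    (by
      apply DifferentiableOn.diffContOnCl
      have hcl : closure (HadamardThreeLines.verticalStrip 0 1) ⊆ {v : ℂ | v.re ≤ 1} := by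
        apply closure_minimal
        · intro v hv
          exact hv.2.le
        · exact isClosed_le continuous_re continuous_const
      refine DifferentiableOn.comp (g := F) hd (by fun_prop) ?_
      intro v hv
      exact closedBall_subset_ball (by linarith) (hn v (hcl hv)))
    (by
      refine ⟨M, ?_⟩
      rintro _ ⟨v, hv, rfl⟩
      exact hbc _ (hn v hv.2))
    (by
      intro v hv
      apply hs
      have : v.re = 0 := hv
      simp [Complex.norm_exp, abs_of_pos hr, this])
    (by
      intro v hv
      exact hbc _ (hn v (le_of_eq hv)))
  simp only [hexp, sub_zero, div_one] at key
  refine key.trans ?_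
  refine mul_le_mul ?_ ?_ (by positivity) hk0.le
  · exact Real.rpow_le_rpow_of_exponent_ge hκ hκ1 (by linarith)
  · simpa using Real.rpow_le_rpow_of_exponent_le hM1 (by linarith : w.re ≤ 1)

lemma zz_chain (A r : ℝ) (hr : 0 < r) (hA : 0 < A) (N : ℕ) : ∀ ε : ℝ, 0 < ε → ∃ κ : ℝ, 0 < κ ∧
    ∀ (F : ℂ → ℂ) (c : ℂ) (d : ℝ), 0 ≤ d → d ≤ r / 2 →
    (∀ k : ℕ, k ≤ N → DifferentiableOn ℂ F (ball (c - k * d) (4 * r))) →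
    (∀ k : ℕ, k ≤ N → ∀ z ∈ ball (c - k * d) (4 * r), (F z).re ≤ A) →
    (∀ z ∈ closedBall c r, ‖F z‖ ≤ κ) →
    ∀ z ∈ closedBall (c - N * d) r, ‖F z‖ ≤ ε := by
  induction N with
  | zero =>
    intro ε hε
    refine ⟨ε, hε, ?_⟩
    intro F c d _ _ _ _ h z hz
    exact h z (by simpa using hz)
  | succ N ih =>
    intro ε hε
    set κ' : ℝ := min 1 ((ε / (6 * A + 7)) ^ 2) with hκ'
    have hκpos : 0 < κ' := by positivity
    obtain ⟨κ, hκ, H⟩ := ih κ' hκpos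
    refine ⟨κ, hκ, ?_⟩
    intro F c d hd0 hd1 hdiff hre hs z hz
    have h1 := H F c d hd0 hd1 (fun k hk => hdiff k (by omega)) (fun k hk => hre k (by omega)) hs
    have h2 := zz_step F (c - N * d) r A κ' hr hA hκpos (min_le_left _ _)
      (hdiff N (by omega)) (hre N (by omega)) h1 z ?_
    · refine h2.trans ?_
      have : κ' ^ (1 / 2 : ℝ) ≤ ε / (6 * A + 7) := by
        rw [← Real.sqrt_eq_rpow]
        exact Real.sqrt_le_iff.2 ⟨by positivity, min_le_right _ _⟩
      rwa [le_div_iff₀ (by positivity)] at this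
    · rw [mem_closedBall] at hz ⊢
      have : dist (c - ((N + 1 : ℕ) : ℂ) * d) (c - N * d) = d := by
        rw [dist_eq_norm]
        have : c - ((N + 1 : ℕ) : ℂ) * d - (c - N * d) = ((-d : ℝ) : ℂ) := by push_cast; ring
        rw [this, Complex.norm_real, norm_neg, Real.norm_of_nonneg hd0]
      have := dist_triangle z (c - ((N + 1 : ℕ) : ℂ) * d) (c - N * d)
      linarith

lemma zz_log (U : Set ℂ) (hU : IsOpen U) (hc : Convex ℝ U) (g : ℂ → ℂ)
    (hg : DifferentiableOn ℂ g U) (h0 : ∀ z ∈ U, g z ≠ 0) (c : ℂ) (hcU : c ∈ U) :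
    ∃ f : ℂ → ℂ, DifferentiableOn ℂ f U ∧ (∀ z ∈ U, Complex.exp (f z) = g z) ∧
      f c = Complex.log (g c) := by
  have hsc : IsSimplyConnected U := by
    have := hc.contractibleSpace ⟨c, hcU⟩
    exact (inferInstance : SimplyConnectedSpace U)
  obtain ⟨f, hf, hfe⟩ := exists_continuousOn_eqOn_exp_comp hsc hU hg.continuousOn
    (by rintro ⟨z, hz, h⟩; exact h0 z hz h)
  have hfe' : ∀ z ∈ U, Complex.exp (f z) = g z := fun z hz => hfe hz
  have hfd : DifferentiableOn ℂ f U := by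
    intro z hz
    have hz' := hU.mem_nhds hz
    have h1 := (hg.differentiableAt hz').hasDerivAt
    have := (Complex.hasDerivAt_exp (f z)).hasFDerivAt.of_comp_of_leftInverse
      (f'symm := ContinuousLinearMap.toSpanSingleton ℂ (Complex.exp (f z))⁻¹)
      (hf.continuousAt hz') h1.hasFDerivAt (by
        filter_upwards [hz'] with y hy using hfe' y hy)
      (by intro x; simp [Complex.exp_ne_zero])
    exact this.differentiableAt.differentiableWithinAt
  refine ⟨fun z => f z + (Complex.log (g c) - f c), by fun_prop, ?_, by simp⟩
  intro z hz
  rw [Complex.exp_add, Complex.exp_sub, Complex.exp_log (h0 c hcU), hfe' z hz, hfe' c hcU,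
    div_self (h0 c hcU), mul_one]

lemma zz_mellin_bound (f : ℝ → ℂ) (a b : ℝ) (ha : MellinConvergent f a) (hb : MellinConvergent f b) :
    ∃ C : ℝ, 0 ≤ C ∧ ∀ s : ℂ, a ≤ s.re → s.re ≤ b → ‖mellin f s‖ ≤ C := by
  have hI := ha.norm.add hb.norm
  refine ⟨_, ?_, fun s hsa hsb => MeasureTheory.norm_integral_le_of_norm_le hI ?_⟩
  · exact MeasureTheory.integral_nonneg fun x => add_nonneg (norm_nonneg _) (norm_nonneg _)
  · filter_upwards [MeasureTheory.ae_restrict_mem measurableSet_Ioi] with x hx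
    have hx : 0 < x := hx
    simp only [norm_smul, Complex.norm_cpow_eq_rpow_re_of_pos hx, Pi.add_apply, sub_re, one_re, ofReal_re]
    rw [← add_mul]
    gcongr
    rcases le_total 1 x with h | h
    · have := Real.rpow_le_rpow_of_exponent_le h (by linarith : s.re - 1 ≤ b - 1)
      have : 0 ≤ x ^ (a - 1) := by positivity
      linarith
    · have := Real.rpow_le_rpow_of_exponent_ge hx h (by linarith : a - 1 ≤ s.re - 1)
      have : 0 ≤ x ^ (b - 1) := by positivity
      linarith

lemma zz_Lambda_bound : ∃ C : ℝ, 0 ≤ C ∧ ∀ s : ℂ, -2 ≤ s.re → s.re ≤ 3 →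
    ‖completedRiemannZeta₀ s‖ ≤ C := by
  have hconv : ∀ s, MellinConvergent (HurwitzZeta.hurwitzEvenFEPair 0).f_modif s := fun s =>
    ((HurwitzZeta.hurwitzEvenFEPair 0).isStrongFEPair_toStrongFEPair.hasMellin s).1
  obtain ⟨C, hC, h⟩ := zz_mellin_bound _ (-1) (3 / 2) (hconv _) (hconv _)
  refine ⟨C, hC, fun s h1 h2 => ?_⟩
  have h3 : completedRiemannZeta₀ s = mellin (HurwitzZeta.hurwitzEvenFEPair 0).f_modif (s / 2) / 2 := rfl
  rw [h3, norm_div]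
  have hre : (s / 2).re = s.re / 2 := by simp
  have := h (s / 2) (by rw [hre]; linarith) (by rw [hre]; linarith)
  simp only [Complex.norm_ofNat]
  linarith [norm_nonneg (mellin (HurwitzZeta.hurwitzEvenFEPair 0).f_modif (s / 2))]

lemma zz_Gamma_bound : ∃ C : ℝ, 0 ≤ C ∧ ∀ s : ℂ, 1 / 2 ≤ s.re → s.re ≤ 3 → ‖Gamma s‖ ≤ C := by
  have hconv : ∀ s : ℂ, 0 < s.re → MellinConvergent (fun x : ℝ => (Real.exp (-x) : ℂ)) s := by
    intro s hs
    have := Complex.GammaIntegral_convergent hs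
    refine this.congr_fun ?_ measurableSet_Ioi
    intro x hx
    simp [mul_comm]
  obtain ⟨C, hC, h⟩ := zz_mellin_bound _ (1 / 2) 3 (hconv _ (by simp)) (hconv _ (by simp))
  refine ⟨C, hC, fun s h1 h2 => ?_⟩
  rw [Complex.Gamma_eq_integral (by linarith), Complex.GammaIntegral_eq_mellin]
  exact h s h1 h2

lemma zz_sin_bound (z : ℂ) : ‖sin z‖ ≤ Real.exp |z.im| := by
  rw [Complex.sin]
  have h1 : ‖cexp (-z * I)‖ ≤ Real.exp |z.im| := by
    rw [Complex.norm_exp]; simp [le_abs_self]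
  have h2 : ‖cexp (z * I)‖ ≤ Real.exp |z.im| := by
    rw [Complex.norm_exp]; simp [neg_le_abs]
  rw [norm_div, norm_mul, Complex.norm_I, mul_one, Complex.norm_ofNat]
  linarith [norm_sub_le (cexp (-z * I)) (cexp (z * I))]

lemma zz_inv_Gamma_bound : ∃ C : ℝ, 0 ≤ C ∧ ∀ w : ℂ, 0 ≤ w.re → w.re ≤ 5 / 2 → 1 ≤ |w.im| →
    ‖(Gamma w)⁻¹‖ ≤ C * Real.exp (Real.pi * |w.im|) := by
  obtain ⟨C, hC, h⟩ := zz_Gamma_bound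
  refine ⟨C, hC, fun w h1 h2 h3 => ?_⟩
  have him : w.im ≠ 0 := by intro h; rw [h] at h3; norm_num at h3
  have n1 : (1 : ℝ) ≤ ‖1 - w‖ := h3.trans (by simpa using Complex.abs_im_le_norm (1 - w))
  have n2 : (1 : ℝ) ≤ ‖2 - w‖ := h3.trans (by simpa using Complex.abs_im_le_norm (2 - w))
  have z1 : 1 - w ≠ 0 := by intro h; rw [h] at n1; norm_num at n1
  have z2 : 2 - w ≠ 0 := by intro h; rw [h] at n2; norm_num at n2
  have hG : Gamma (3 - w) = (2 - w) * ((1 - w) * Gamma (1 - w)) := by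
    rw [← Complex.Gamma_add_one _ z1, show 1 - w + 1 = 2 - w by ring, ← Complex.Gamma_add_one _ z2]
    congr 1; ring
  have hsin : sin (Real.pi * w) ≠ 0 := by
    intro hs
    rw [Complex.sin_eq_zero_iff] at hs
    obtain ⟨k, hk⟩ := hs
    have := congrArg Complex.im hk
    simp [Real.pi_ne_zero, him] at this
  have hr := Complex.Gamma_mul_Gamma_one_sub w
  have hpi : (Real.pi : ℂ) ≠ 0 := by exact_mod_cast Real.pi_ne_zero
  have hg0 : Gamma w ≠ 0 := by
    intro h0; rw [h0, zero_mul] at hr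
    exact div_ne_zero hpi hsin hr.symm
  have hinv : (Gamma w)⁻¹ = Gamma (1 - w) * sin (Real.pi * w) / Real.pi := by
    rw [eq_div_iff hsin] at hr
    rw [eq_div_iff hpi, inv_mul_eq_iff_eq_mul₀ hg0]
    linear_combination -hr
  have hb : ‖Gamma (1 - w)‖ ≤ C := by
    have := h (3 - w) (by simp; linarith) (by simp; linarith)
    rw [hG, norm_mul, norm_mul] at this
    refine le_trans ?_ this
    have := norm_nonneg (Gamma (1 - w))
    nlinarith [mul_le_mul n1 le_rfl this (by linarith),mul_le_mul n2 (mul_le_mul n1 le_rfl this (by linarith)) (by positivity) (by linarith)]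
  have hs := zz_sin_bound (Real.pi * w)
  have : |(Real.pi * w : ℂ).im| = Real.pi * |w.im| := by
    simp [abs_mul, abs_of_pos Real.pi_pos]
  rw [this] at hs
  rw [hinv, norm_div, norm_mul, Complex.norm_real, Real.norm_of_nonneg Real.pi_pos.le]
  have hm : ‖Gamma (1 - w)‖ * ‖sin (Real.pi * w)‖ ≤ C * Real.exp (Real.pi * |w.im|) := by gcongr
  exact (div_le_self (by positivity) (by linarith [Real.pi_gt_three])).trans hm

lemma zz_zeta1_eq {s : ℂ} (hs : s ≠ 1) : riemannZeta₁ s = (s - 1) * riemannZeta s := by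
  rw [riemannZeta_eq_inv_sub_mul hs, mul_inv_cancel_left₀ (sub_ne_zero.2 hs)]

lemma zz_apriori : ∃ C : ℝ, 0 ≤ C ∧ ∀ s : ℂ, -2 ≤ s.re → s.re ≤ 3 → 2 ≤ |s.im| →
    ‖riemannZeta₁ s‖ ≤ C * Real.exp (6 * |s.im|) := by
  obtain ⟨C, hC, h⟩ := zz_Lambda_bound
  obtain ⟨D, hD, h'⟩ := zz_inv_Gamma_bound
  refine ⟨60 * (C + 2) * D, by positivity, fun s h1 h2 h3 => ?_⟩
  have hs1 : s ≠ 1 := by rintro rfl; norm_num at h3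
  have him : |s.im| ≤ Real.exp |s.im| := by linarith [Real.add_one_le_exp |s.im|]
  set E := Real.exp |s.im| with hE
  have hE1 : 2 ≤ E := h3.trans him
  have hsn : ‖s‖ ≤ 3 * E := by
    have := Complex.norm_le_abs_re_add_abs_im s
    have : |s.re| ≤ 3 := abs_le.2 ⟨by linarith, h2⟩
    linarith
  have hs1n : ‖s - 1‖ ≤ 4 * E := by
    have := norm_sub_le s 1
    simp at this; linarith
  have hw := h' (s / 2 + 1) (by simp; linarith) (by simp; linarith)
    (by simp [abs_div]; linarith)
  have hwi : |(s / 2 + 1).im| = |s.im| / 2 := by simp [abs_div]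
  have hexpw : Real.exp (Real.pi * |(s / 2 + 1).im|) ≤ E ^ 2 := by
    rw [hwi, hE, ← Real.exp_nat_mul]
    apply Real.exp_le_exp.2
    push_cast
    nlinarith [Real.pi_lt_four]
  have hpi : ‖((Real.pi : ℂ) ^ (-s / 2))⁻¹‖ ≤ E ^ 2 + 30 := by
    rw [norm_inv, Complex.norm_cpow_eq_rpow_re_of_pos Real.pi_pos, ← Real.rpow_neg Real.pi_pos.le]
    have : -(-s / 2).re ≤ 3 / 2 := by simp; linarith
    calc Real.pi ^ (-(-s / 2).re) ≤ Real.pi ^ (2 : ℝ) :=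
          Real.rpow_le_rpow_of_exponent_le (by linarith [Real.pi_gt_three]) (by linarith)
      _ ≤ _ := by rw [Real.rpow_two]; nlinarith [Real.pi_lt_four, Real.pi_pos]
  have hnum : ‖s * completedRiemannZeta₀ s - 1 - s / (1 - s)‖ ≤ 3 * E * (C + 2) := by
    have n1 : (2 : ℝ) ≤ ‖1 - s‖ := h3.trans (by simpa using Complex.abs_im_le_norm (1 - s))
    have a1 : ‖s / (1 - s)‖ ≤ ‖s‖ := by
      rw [norm_div]; exact div_le_self (norm_nonneg _) (by linarith)
    have a2 : ‖s * completedRiemannZeta₀ s‖ ≤ 3 * E * C := by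
      rw [norm_mul]; have := h s h1 h2; gcongr
    have a3 := norm_sub_le (s * completedRiemannZeta₀ s - 1) (s / (1 - s))
    have a4 := norm_sub_le (s * completedRiemannZeta₀ s) 1
    rw [norm_one] at a4
    linarith
  rw [zz_zeta1_eq hs1, riemannZeta_eq_mul_completedRiemannZeta₀ s, norm_mul, div_eq_mul_inv,
    norm_mul, mul_inv, mul_inv, norm_mul, norm_mul]
  have e6 : Real.exp (6 * |s.im|) = E ^ 6 := by rw [hE, ← Real.exp_nat_mul]; norm_num
  have hE30 : E ^ 2 + 30 ≤ 10 * E ^ 2 := by nlinarith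
  have h2i : ‖(2 : ℂ)⁻¹‖ = 1 / 2 := by simp
  rw [e6, h2i]
  calc _ ≤ (4 * E) * ((3 * E * (C + 2)) * (1 / 2 * (10 * E ^ 2) * (D * E ^ 2))) := by
        have := hpi.trans hE30
        have h5 : ‖(Gamma (s / 2 + 1))⁻¹‖ ≤ D * E ^ 2 := hw.trans (by gcongr)
        gcongr
    _ ≤ _ := by
        have : 0 ≤ (C + 2) * D * E ^ 6 := by positivity
        nlinarith

lemma zz_zeta_near_one (s : ℂ) (hs : 2 ≤ s.re) : ‖riemannZeta s - 1‖ ≤ 65 / 100 := by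
  have h2 := hasSum_zeta_two
  have hS : HasSum (fun n : ℕ => 1 / ((n : ℝ) + 2) ^ 2) (Real.pi ^ 2 / 6 - 1) := by
    have := (hasSum_nat_add_iff' (f := fun n : ℕ => 1 / (n : ℝ) ^ 2) 2).2 h2
    simpa [Finset.sum_range_succ] using this
  have hterm : ∀ n : ℕ, ‖1 / ((n : ℂ) + 2) ^ s‖ ≤ 1 / ((n : ℝ) + 2) ^ 2 := by
    intro n
    have hn : (0 : ℝ) < n + 2 := by positivity
    have hc : ((n : ℂ) + 2) = (((n : ℝ) + 2 : ℝ) : ℂ) := by push_cast; ring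
    rw [norm_div, norm_one, hc, Complex.norm_cpow_eq_rpow_re_of_pos hn]
    gcongr
    rw [← Real.rpow_two]
    exact Real.rpow_le_rpow_of_exponent_le (by linarith) hs
  have hsum : Summable (fun n : ℕ => 1 / ((n : ℂ) + 2) ^ s) :=
    Summable.of_norm_bounded hS.summable hterm
  have hz : riemannZeta s - 1 = ∑' n : ℕ, 1 / ((n : ℂ) + 2) ^ s := by
    rw [zeta_eq_tsum_one_div_nat_add_one_cpow (by linarith)]
    have hs' : Summable (fun n : ℕ => 1 / ((n : ℂ) + 1) ^ s) := by
      rw [← summable_nat_add_iff 1]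
      refine hsum.congr fun n => ?_
      push_cast; ring_nf
    rw [hs'.tsum_eq_zero_add]
    simp only [Nat.cast_zero, zero_add, one_cpow, div_one, add_sub_cancel_left]
    refine tsum_congr fun n => ?_
    push_cast; ring_nf
  rw [hz]
  refine (tsum_of_norm_bounded hS hterm).trans ?_
  nlinarith [Real.pi_lt_d4, Real.pi_pos]

lemma zz_zeta_bds (s : ℂ) (hs : 2 ≤ s.re) : ‖riemannZeta s‖ ≤ 165 / 100 ∧ 35 / 100 ≤ ‖riemannZeta s‖ := by
  have h := zz_zeta_near_one s hs
  have h1 := norm_sub_norm_le (riemannZeta s) 1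
  have h2 := norm_sub_norm_le 1 (riemannZeta s)
  rw [norm_sub_rev] at h2
  rw [norm_one] at h1 h2
  constructor <;> linarith

lemma zz_Gamma_sq (u : ℝ) : ‖Gamma (1 + u * I)‖ ^ 2 * Real.sinh (Real.pi * u) = Real.pi * u := by
  rcases eq_or_ne u 0 with rfl | hu
  · simp
  have hI : (u : ℂ) * I ≠ 0 := mul_ne_zero (by exact_mod_cast hu) I_ne_zero
  have h1 : Gamma (1 + u * I) = (u * I) * Gamma (u * I) := by
    rw [← Complex.Gamma_add_one _ hI, add_comm]
  have h2 : (starRingEnd ℂ) (Gamma (1 + u * I)) = Gamma (1 - u * I) := by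
    rw [← Complex.Gamma_conj]; congr 1; simp [sub_eq_add_neg]
  have h3 := Complex.Gamma_mul_Gamma_one_sub (u * I)
  have h4 : sin (Real.pi * (u * I)) = Complex.sinh ((Real.pi * u : ℝ) : ℂ) * I := by
    rw [← Complex.sin_mul_I]; congr 1; push_cast; ring
  have hsh : Real.sinh (Real.pi * u) ≠ 0 := by
    rw [Ne, Real.sinh_eq_zero]; exact mul_ne_zero Real.pi_ne_zero hu
  have hshc : Complex.sinh ((Real.pi * u : ℝ) : ℂ) ≠ 0 := by
    rw [← Complex.ofReal_sinh]; exact_mod_cast hsh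
  have h5 : ((‖Gamma (1 + u * I)‖ ^ 2 * Real.sinh (Real.pi * u) : ℝ) : ℂ) = ((Real.pi * u : ℝ) : ℂ) := by
    push_cast
    rw [← Complex.mul_conj', h2, h1]
    rw [h4, eq_div_iff (mul_ne_zero hshc I_ne_zero)] at h3
    push_cast at h3
    linear_combination (u : ℂ) * h3
  exact_mod_cast h5

lemma zz_Gamma_sq' (u : ℝ) : ‖Gamma (1 + u * I)‖ ^ 2 *
    (2 * Real.sinh (Real.pi * u / 2) * Real.cosh (Real.pi * u / 2)) = Real.pi * u := by
  have h := zz_Gamma_sq u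
  rwa [show Real.pi * u = 2 * (Real.pi * u / 2) by ring, Real.sinh_two_mul,
    show 2 * (Real.pi * u / 2) = Real.pi * u by ring] at h

lemma zz_abs_sinh_le (x : ℝ) : |Real.sinh x| ≤ Real.cosh x := by
  exact abs_le_of_sq_le_sq (by nlinarith [Real.cosh_sq x]) (Real.cosh_pos x).le

lemma zz_Gamma_sinh (u : ℝ) : (‖Gamma (1 + u * I)‖ * |Real.sinh (Real.pi * u / 2)|) ^ 2 ≤ 2 * |u| := by
  have h := zz_Gamma_sq' u
  have hc := Real.cosh_pos (Real.pi * u / 2)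
  have hs := zz_abs_sinh_le (Real.pi * u / 2)
  set g := ‖Gamma (1 + u * I)‖ ^ 2 with hg
  have hg0 : 0 ≤ g := by positivity
  rw [mul_pow, ← hg]
  have h' := congrArg abs h
  rw [abs_mul, abs_mul, abs_mul, abs_mul, abs_of_nonneg hg0, abs_of_pos hc, abs_of_pos Real.pi_pos,
    abs_two] at h'
  have h1 : g * |Real.sinh (Real.pi * u / 2)| ^ 2 ≤
      g * (|Real.sinh (Real.pi * u / 2)| * Real.cosh (Real.pi * u / 2)) := by
    rw [sq]; gcongr
  nlinarith [Real.pi_lt_four, abs_nonneg u]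

lemma zz_Gamma_cosh (u : ℝ) : |u| ≤ (‖Gamma (1 + u * I)‖ * Real.cosh (Real.pi * u / 2)) ^ 2 := by
  have h := zz_Gamma_sq' u
  have hc := Real.cosh_pos (Real.pi * u / 2)
  have hs := zz_abs_sinh_le (Real.pi * u / 2)
  set g := ‖Gamma (1 + u * I)‖ ^ 2 with hg
  have hg0 : 0 ≤ g := by positivity
  rw [mul_pow, ← hg]
  have h' := congrArg abs h
  rw [abs_mul, abs_mul, abs_mul, abs_mul, abs_of_nonneg hg0, abs_of_pos hc, abs_of_pos Real.pi_pos,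
    abs_two] at h'
  have h1 : g * (|Real.sinh (Real.pi * u / 2)| * Real.cosh (Real.pi * u / 2)) ≤
      g * Real.cosh (Real.pi * u / 2) ^ 2 := by
    rw [sq]; gcongr
  nlinarith [Real.pi_gt_three, abs_nonneg u]

lemma zz_twopi (w : ℂ) : ‖(2 * (2 * Real.pi : ℂ) ^ (-w))‖ = 2 * ((2 * Real.pi) ^ w.re)⁻¹ := by
  have : (2 * Real.pi : ℂ) = ((2 * Real.pi : ℝ) : ℂ) := by push_cast; ring
  rw [norm_mul, this, Complex.norm_cpow_eq_rpow_re_of_pos (by positivity), neg_re,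
    Real.rpow_neg (by positivity)]
  simp

lemma zz_one_add (u : ℝ) : (1 + u * I : ℂ) ≠ 0 := by
  intro h; have := congrArg re h; simp at this

lemma zz_line_left (t : ℝ) : ‖riemannZeta₁ (-2 + t * I)‖ ≤ 48 * ‖(-2 + t * I : ℂ) + 4‖ ^ 4 := by
  set s : ℂ := -2 + t * I with hs
  set u : ℝ := -t with hu
  set w : ℂ := 3 + u * I with hw
  have hsw : s = 1 - w := by rw [hs, hw, hu]; push_cast; ring
  have hwre : w.re = 3 := by simp [hw]
  have hs1 : s ≠ 1 := by intro h; have := congrArg re h; simp [hs] at this; norm_num at this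
  have hfe := riemannZeta_one_sub (s := w)
    (by intro n h; have := congrArg re h; rw [hwre] at this; simp at this
        have h0 : (0 : ℝ) ≤ n := by positivity
        linarith)
    (by intro h; have := congrArg re h; rw [hwre] at this; simp at this)
  rw [← hsw] at hfe
  have hG : Gamma w = (2 + u * I) * ((1 + u * I) * Gamma (1 + u * I)) := by
    rw [← Complex.Gamma_add_one _ (zz_one_add u), show (1 + u * I + 1 : ℂ) = 2 + u * I by ring,
      ← Complex.Gamma_add_one]
    · rw [hw]; congr 1; ring
    · intro h; have := congrArg re h; simp at this
  have hcos : cos (Real.pi * w / 2) = sinh ((Real.pi * u / 2 : ℝ) : ℂ) * I := by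
    rw [← Complex.sin_mul_I]
    have : (Real.pi * w / 2 : ℂ) = ((Real.pi * u / 2 : ℝ) : ℂ) * I - Real.pi / 2 + 2 * Real.pi := by
      rw [hw]; push_cast; ring
    rw [this, Complex.cos_add_two_pi, Complex.cos_sub_pi_div_two]
  have hcn : ‖cos (Real.pi * w / 2)‖ = |Real.sinh (Real.pi * u / 2)| := by
    rw [hcos, norm_mul, norm_I, mul_one, ← Complex.ofReal_sinh, Complex.norm_real, Real.norm_eq_abs]
  set X := ‖s + 4‖ with hX
  have hX2 : X = ‖(2 + u * I : ℂ)‖ := by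
    rw [hX, ← Complex.norm_conj]; congr 1
    apply Complex.ext <;> simp [hs, hu]; norm_num
  have hX1 : 1 ≤ X := by
    have := Complex.abs_re_le_norm (2 + u * I : ℂ)
    simp at this; linarith
  have hXu : |u| ≤ X := by
    rw [hX2]; simpa using Complex.abs_im_le_norm (2 + u * I : ℂ)
  have hX3 : ‖(1 + u * I : ℂ)‖ ≤ 2 * X := by
    have := Complex.norm_le_abs_re_add_abs_im (1 + u * I : ℂ)
    simp at this; linarith
  have hX4 : ‖s - 1‖ ≤ 6 * X := by
    have h := norm_sub_le (s + 4) 5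
    rw [show s + 4 - 5 = s - 1 by ring] at h
    have h5 : ‖(5 : ℂ)‖ = 5 := by simp
    rw [h5] at h
    linarith
  have hgs : ‖Gamma (1 + u * I)‖ * |Real.sinh (Real.pi * u / 2)| ≤ 2 * X := by
    refine abs_le_of_sq_le_sq' ?_ (by positivity) |>.2
    refine (zz_Gamma_sinh u).trans (by nlinarith)
  have hz := (zz_zeta_bds w (by rw [hwre]; norm_num)).1
  have h2p : ‖(2 * (2 * Real.pi : ℂ) ^ (-w))‖ ≤ 1 := by
    rw [zz_twopi, hwre, ← div_eq_mul_inv, div_le_one (by positivity)]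
    have : (2 * Real.pi) ^ (1 : ℝ) ≤ (2 * Real.pi) ^ (3 : ℝ) :=
      Real.rpow_le_rpow_of_exponent_le (by linarith [Real.pi_gt_three]) (by norm_num)
    rw [Real.rpow_one] at this
    linarith [Real.pi_gt_three]
  have hn : ‖riemannZeta s‖ = ‖(2 * (2 * Real.pi : ℂ) ^ (-w))‖ * (X * (‖(1 + u * I : ℂ)‖ *
      ‖Gamma (1 + u * I)‖)) * |Real.sinh (Real.pi * u / 2)| * ‖riemannZeta w‖ := by
    rw [hX2, ← hcn, ← norm_mul, ← norm_mul, ← hG, ← norm_mul, ← norm_mul, ← norm_mul, hfe]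
  rw [zz_zeta1_eq hs1, norm_mul, hn]
  calc _ = ‖s - 1‖ * (‖(2 * (2 * Real.pi : ℂ) ^ (-w))‖ * (X * ‖(1 + u * I : ℂ)‖) *
        (‖Gamma (1 + u * I)‖ * |Real.sinh (Real.pi * u / 2)|) * ‖riemannZeta w‖) := by ring
    _ ≤ (6 * X) * (1 * (X * (2 * X)) * (2 * X) * 2) := by
        have : ‖riemannZeta w‖ ≤ 2 := by linarith
        gcongr
    _ = _ := by ring

lemma zz_line_right (t : ℝ) : ‖riemannZeta₁ (3 + t * I)‖ ≤ 48 * ‖(3 + t * I : ℂ) + 4‖ ^ 4 := by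
  set s : ℂ := 3 + t * I with hs
  have hs1 : s ≠ 1 := by intro h; have := congrArg re h; simp [hs] at this
  have hz := (zz_zeta_bds s (by simp [hs]; norm_num)).1
  set X := ‖s + 4‖ with hX
  have hX1 : 1 ≤ X := by
    have := Complex.abs_re_le_norm (s + 4)
    simp [hs] at this
    rw [← hX] at this
    norm_num at this
    simp [hs] at hX
    rw [hX]
    linarith
  have hX4 : ‖s - 1‖ ≤ 6 * X := by
    have h := norm_sub_le (s + 4) 5
    rw [show s + 4 - 5 = s - 1 by ring] at h
    have h5 : ‖(5 : ℂ)‖ = 5 := by simp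
    rw [h5] at h
    linarith
  rw [zz_zeta1_eq hs1, norm_mul]
  calc _ ≤ (6 * X) * 2 := by
        have : ‖riemannZeta s‖ ≤ 2 := by linarith
        gcongr
    _ ≤ _ := by
        have : X ^ 1 ≤ X ^ 4 := pow_le_pow_right₀ hX1 (by norm_num)
        linarith

lemma zz_add_four (s : ℂ) (h : -2 ≤ s.re) : 1 ≤ ‖s + 4‖ := by
  have := Complex.re_le_norm (s + 4)
  simp at this
  linarith

lemma zz_zeta1_bound (s : ℂ) (h1 : -2 ≤ s.re) (h2 : s.re ≤ 3) :
    ‖riemannZeta₁ s‖ ≤ 48 * ‖s + 4‖ ^ 4 := by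
  obtain ⟨C, hC, hb⟩ := zz_apriori
  have hne : ∀ z : ℂ, -2 ≤ z.re → z + 4 ≠ 0 := by
    intro z hz h0
    have := zz_add_four z hz
    rw [h0] at this
    norm_num at this
  have key : ‖(fun z : ℂ => riemannZeta₁ z / (z + 4) ^ 4) s‖ ≤ 48 := by
    refine PhragmenLindelof.vertical_strip (f := fun z : ℂ => riemannZeta₁ z / (z + 4) ^ 4) (a := -2) (b := 3) ?_ ?_ ?_ ?_ h1 h2
    · apply DifferentiableOn.diffContOnCl
      intro z hz
      have hz' : -2 ≤ z.re := by
        have : closure (re ⁻¹' Ioo (-2 : ℝ) 3) ⊆ re ⁻¹' Ici (-2 : ℝ) :=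
          closure_minimal (fun w hw => hw.1.le) (isClosed_Ici.preimage continuous_re)
        exact this hz
      apply DifferentiableAt.differentiableWithinAt
      exact (differentiable_riemannZeta₁ z).div (by fun_prop) (pow_ne_zero _ (hne z hz'))
    · refine ⟨1 / 2, by rw [lt_div_iff₀] <;> norm_num; linarith [Real.pi_gt_three], 12, ?_⟩
      apply Asymptotics.IsBigO.of_bound C
      have hev : ∀ᶠ z : ℂ in comap (abs ∘ im) atTop, 2 ≤ |z.im| :=
        tendsto_comap.eventually (eventually_ge_atTop 2)
      filter_upwards [hev.filter_mono inf_le_left, mem_inf_of_right (mem_principal_self _)] with z hz hz2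
      have hz2' : -2 < z.re ∧ z.re < 3 := hz2
      have ha := hb z hz2'.1.le hz2'.2.le hz
      have h4 := zz_add_four z hz2'.1.le
      rw [norm_div, norm_pow, Real.norm_eq_abs, abs_of_pos (Real.exp_pos _)]
      calc _ ≤ ‖riemannZeta₁ z‖ := div_le_self (norm_nonneg _) (one_le_pow₀ h4)
        _ ≤ _ := ha
        _ ≤ _ := by
          have := Real.add_one_le_exp (1 / 2 * |z.im|)
          exact mul_le_mul_of_nonneg_left (Real.exp_le_exp.2 (by linarith)) hC
    · intro z hz
      have hzz : z = -2 + z.im * I := by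
        apply Complex.ext <;> simp [hz]
      have h4 := zz_add_four z hz.ge
      rw [norm_div, norm_pow, div_le_iff₀ (by positivity)]
      have := zz_line_left z.im
      rwa [← hzz] at this
    · intro z hz
      have hzz : z = 3 + z.im * I := by
        apply Complex.ext <;> simp [hz]
      have h4 := zz_add_four z (by linarith)
      rw [norm_div, norm_pow, div_le_iff₀ (by positivity)]
      have := zz_line_right z.im
      rwa [← hzz] at this
  have h4 := zz_add_four s h1
  simp only [norm_div, norm_pow] at key
  rwa [div_le_iff₀ (by positivity)] at key

lemma zz_zeta_bound (s : ℂ) (h1 : -2 ≤ s.re) (h2 : s.re ≤ 3) (h3 : 1 ≤ s.im) :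
    ‖riemannZeta s‖ ≤ 48 * ‖s + 4‖ ^ 4 := by
  have hs1 : s ≠ 1 := by rintro rfl; norm_num at h3
  have h := zz_zeta1_bound s h1 h2
  rw [zz_zeta1_eq hs1, norm_mul] at h
  have h5 : 1 ≤ ‖s - 1‖ := by
    have := Complex.abs_im_le_norm (s - 1)
    simp at this
    linarith [le_abs_self s.im]
  nlinarith [norm_nonneg (riemannZeta s)]

lemma zz_lower (t : ℝ) (ht : 3600 ≤ t) : t ≤ ‖riemannZeta (-1 + t * I)‖ := by
  set s : ℂ := -1 + t * I with hs
  set u : ℝ := -t with hu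
  set w : ℂ := 2 + u * I with hw
  have hsw : s = 1 - w := by rw [hs, hw, hu]; push_cast; ring
  have hwre : w.re = 2 := by simp [hw]
  have hfe := riemannZeta_one_sub (s := w)
    (by intro n h; have := congrArg re h; rw [hwre] at this; simp at this
        have h0 : (0 : ℝ) ≤ n := by positivity
        linarith)
    (by intro h; have := congrArg re h; rw [hwre] at this; simp at this)
  rw [← hsw] at hfe
  have hG : Gamma w = (1 + u * I) * Gamma (1 + u * I) := by
    rw [← Complex.Gamma_add_one _ (zz_one_add u), show (1 + u * I + 1 : ℂ) = 2 + u * I by ring]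
  have hcos : cos (Real.pi * w / 2) = - cosh ((Real.pi * u / 2 : ℝ) : ℂ) := by
    rw [← Complex.cos_mul_I]
    have : (Real.pi * w / 2 : ℂ) = ((Real.pi * u / 2 : ℝ) : ℂ) * I + Real.pi := by
      rw [hw]; push_cast; ring
    rw [this, Complex.cos_add_pi]
  have hcn : ‖cos (Real.pi * w / 2)‖ = Real.cosh (Real.pi * u / 2) := by
    rw [hcos, norm_neg, ← Complex.ofReal_cosh, Complex.norm_real, Real.norm_eq_abs,
      abs_of_pos (Real.cosh_pos _)]
  have hut : |u| = t := by rw [hu, abs_neg, abs_of_nonneg]; linarith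
  have hX : t ≤ ‖(1 + u * I : ℂ)‖ := by
    rw [← hut]; simpa using Complex.abs_im_le_norm (1 + u * I : ℂ)
  have hgs : 60 ≤ ‖Gamma (1 + u * I)‖ * Real.cosh (Real.pi * u / 2) := by
    have h := zz_Gamma_cosh u
    rw [hut] at h
    have h0 : 0 ≤ ‖Gamma (1 + u * I)‖ * Real.cosh (Real.pi * u / 2) :=
      mul_nonneg (norm_nonneg _) (Real.cosh_pos _).le
    nlinarith
  have hz := (zz_zeta_bds w (by rw [hwre])).2
  have h2p : 1 / 20 ≤ ‖(2 * (2 * Real.pi : ℂ) ^ (-w))‖ := by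
    rw [zz_twopi, hwre, Real.rpow_two, ← div_eq_mul_inv, div_le_div_iff₀ (by norm_num) (by positivity)]
    nlinarith [Real.pi_lt_d2, Real.pi_pos]
  have hn : ‖riemannZeta s‖ = ‖(2 * (2 * Real.pi : ℂ) ^ (-w))‖ * (‖(1 + u * I : ℂ)‖ *
      ‖Gamma (1 + u * I)‖) * Real.cosh (Real.pi * u / 2) * ‖riemannZeta w‖ := by
    rw [← hcn, ← norm_mul, ← hG, ← norm_mul, ← norm_mul, ← norm_mul, hfe]
  rw [hn]
  calc t ≤ 1 / 20 * t * 60 * (35 / 100) := by linarith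
    _ ≤ ‖(2 * (2 * Real.pi : ℂ) ^ (-w))‖ * ‖(1 + u * I : ℂ)‖ *
        (‖Gamma (1 + u * I)‖ * Real.cosh (Real.pi * u / 2)) * ‖riemannZeta w‖ := by gcongr
    _ = _ := by ring

lemma zz_core (R : ℝ) (hR : 0 < R) (hR1 : R ≤ 1 / 2) : ∃ T₀ : ℝ, 3600 ≤ T₀ ∧ ∀ τ : ℝ, T₀ ≤ τ →
    ∃ s : ℂ, |s.im - τ| < R ∧ riemannZeta s = 0 := by
  obtain ⟨r, hr4⟩ : ∃ r : ℝ, 4 * r = R := ⟨R / 4, by ring⟩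
  have hr : 0 < r := by linarith
  obtain ⟨N, hN⟩ := exists_nat_ge (7 / r)
  have hN0 : (0 : ℝ) < N := lt_of_lt_of_le (by positivity) hN
  obtain ⟨κ, hκ, hch⟩ := zz_chain 5 r hr (by norm_num) N (1 / 2) (by norm_num)
  refine ⟨3600 + Real.exp (11 / κ), by linarith [Real.exp_pos (11 / κ)], fun τ hτ => ?_⟩
  by_contra hcon
  push Not at hcon
  have hτ1 : 3600 ≤ τ := by linarith [Real.exp_pos (11 / κ)]
  have hτ0 : 0 < τ := by linarith
  obtain ⟨L, hL⟩ : ∃ L, L = Real.log τ := ⟨_, rfl⟩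
  have hLκ : 11 / κ ≤ L := by
    rw [hL, Real.le_log_iff_exp_le hτ0]; linarith
  have hL0 : 0 < L := lt_of_lt_of_le (by positivity) hLκ
  obtain ⟨U, hUdef⟩ : ∃ U : Set ℂ, U = re ⁻¹' Ioo (-2 : ℝ) 3 ∩ im ⁻¹' Ioo (τ - R) (τ + R) := ⟨_, rfl⟩
  have hmem : ∀ z : ℂ, z ∈ U ↔ (-2 < z.re ∧ z.re < 3) ∧ (τ - R < z.im ∧ z.im < τ + R) := by
    intro z; rw [hUdef]; rfl
  have hUo : IsOpen U := by
    rw [hUdef]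
    exact (isOpen_Ioo.preimage continuous_re).inter (isOpen_Ioo.preimage continuous_im)
  have hUc : Convex ℝ U := by
    rw [hUdef]
    exact ((convex_Ioo (-2 : ℝ) 3).linear_preimage Complex.reLm).inter
      ((convex_Ioo (τ - R) (τ + R)).linear_preimage Complex.imLm)
  have hζ0 : ∀ z ∈ U, riemannZeta z ≠ 0 := by
    intro z hz
    rw [hmem] at hz
    exact hcon z (by rw [abs_lt]; constructor <;> linarith [hz.2.1, hz.2.2])
  have hζd : DifferentiableOn ℂ riemannZeta U := by
    intro z hz
    apply (differentiableAt_riemannZeta _).differentiableWithinAt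
    rintro rfl
    rw [hmem] at hz
    have := hz.2.1
    simp at this
    linarith
  obtain ⟨c, hc⟩ : ∃ c : ℂ, c = ((5 / 2 : ℝ) : ℂ) + τ * I := ⟨_, rfl⟩
  have hcre : c.re = 5 / 2 := by simp [hc]
  have hcim : c.im = τ := by simp [hc]
  have hcU : c ∈ U := by
    rw [hmem, hcre, hcim]; norm_num [hR]
  obtain ⟨f, hfd, hfe, hfc⟩ := zz_log U hUo hUc riemannZeta hζd hζ0 c hcU
  have hfre : ∀ z ∈ U, (f z).re = Real.log ‖riemannZeta z‖ := by
    intro z hz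
    rw [← hfe z hz, Complex.norm_exp, Real.log_exp]
  -- balls
  have hball : ∀ x : ℝ, 0 ≤ x → x ≤ 7 / 2 → ∀ z ∈ ball (c - x) (4 * r), z ∈ U ∧ 5 / 2 - x - 1 / 2 < z.re := by
    intro x hx hx2 z hz
    rw [mem_ball, dist_eq_norm, hr4] at hz
    have h1 := (Complex.abs_re_le_norm _).trans_lt hz
    have h2 := (Complex.abs_im_le_norm _).trans_lt hz
    simp only [sub_re, sub_im, hcre, hcim, ofReal_re, ofReal_im] at h1 h2
    rw [abs_lt] at h1 h2
    rw [hmem]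
    refine ⟨⟨⟨?_, ?_⟩, ?_, ?_⟩, ?_⟩ <;> linarith [h1.1, h1.2, h2.1, h2.2]
  have hU5 : ∀ z ∈ U, (f z).re ≤ 5 * L := by
    intro z hz
    rw [hfre z hz]
    have hz' := (hmem z).1 hz
    have hb := zz_zeta_bound z hz'.1.1.le hz'.1.2.le (by linarith [hz'.2.1])
    have h4 : ‖z + 4‖ ≤ 2 * τ := by
      have := Complex.norm_le_abs_re_add_abs_im (z + 4)
      have e1 : |(z + 4).re| ≤ 7 := by
        simp only [add_re]; rw [abs_le]; norm_num; constructor <;> linarith [hz'.1.1, hz'.1.2]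
      have e2 : |(z + 4).im| ≤ τ + 1 := by
        simp only [add_im]; rw [abs_le]; norm_num; constructor <;> linarith [hz'.2.1, hz'.2.2]
      linarith
    have h5 : ‖riemannZeta z‖ ≤ τ ^ 5 := by
      calc _ ≤ 48 * ‖z + 4‖ ^ 4 := hb
        _ ≤ 48 * (2 * τ) ^ 4 := by gcongr
        _ = 768 * τ ^ 4 := by ring
        _ ≤ τ * τ ^ 4 := by gcongr; linarith
        _ = _ := by ring
    have h6 := Real.log_le_log (norm_pos_iff.2 (hζ0 z hz)) h5
    rw [Real.log_pow, ← hL] at h6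
    exact_mod_cast h6
  have hfc6 : ‖f c‖ ≤ 6 := by
    rw [hfc]
    have h := Complex.norm_le_abs_re_add_abs_im (Complex.log (riemannZeta c))
    rw [Complex.log_re, Complex.log_im] at h
    have ha := Complex.abs_arg_le_pi (riemannZeta c)
    obtain ⟨b1, b2⟩ := zz_zeta_bds c (by rw [hcre]; norm_num)
    have hp : 0 < ‖riemannZeta c‖ := by linarith
    have hl1 := Real.log_le_sub_one_of_pos hp
    have hl2 := Real.one_sub_inv_le_log_of_pos hp
    have hinv : ‖riemannZeta c‖⁻¹ ≤ (35 / 100)⁻¹ := inv_anti₀ (by norm_num) b2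
    have : |Real.log ‖riemannZeta c‖| ≤ 2 := by
      rw [abs_le]; norm_num at hinv; constructor <;> linarith
    linarith [Real.pi_lt_d2]
  have hstart : ∀ z ∈ closedBall c r, ‖f z‖ ≤ 11 := by
    intro z hz
    have hz' : ‖z - c‖ ≤ r := by simpa [dist_eq_norm] using hz
    have hb0 : ∀ w ∈ ball (0 : ℂ) (4 * r), c + w ∈ U ∧ 2 < (c + w).re := by
      intro w hw
      have := hball 0 le_rfl (by norm_num) (c + w) (by simpa using hw)
      exact ⟨this.1, by linarith [this.2]⟩
    have h := borelCaratheodory (M := 1) (f := fun w => f (c + w)) (R := 4 * r) (z := z - c) one_pos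
      (hfd.comp (by fun_prop) (fun w hw => (hb0 w hw).1))
      (fun w hw => by
        change (f (c + w)).re ≤ 1
        rw [hfre _ (hb0 w hw).1]
        have b := zz_zeta_bds (c + w) (hb0 w hw).2.le
        have := Real.log_le_sub_one_of_pos (lt_of_lt_of_le (by norm_num) b.2)
        linarith [b.1]) (by positivity)
      (by simp; linarith)
    simp only [add_sub_cancel, add_zero] at h
    refine h.trans ?_
    have hden : 0 < 4 * r - ‖z - c‖ := by linarith
    rw [← add_div, div_le_iff₀ hden]
    have : ‖f c‖ * (4 * r + ‖z - c‖) ≤ 6 * (4 * r + ‖z - c‖) := by gcongr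
    nlinarith [norm_nonneg (z - c)]
  obtain ⟨d, hd⟩ : ∃ d : ℝ, d = (7 / 2) / N := ⟨_, rfl⟩
  have hNd : N * d = 7 / 2 := by rw [hd]; field_simp
  have hd0 : 0 ≤ d := by rw [hd]; positivity
  have hdr : d ≤ r / 2 := by
    rw [div_le_iff₀ hr] at hN
    rw [hd, div_le_iff₀ hN0]; linarith
  have hkd : ∀ k : ℕ, k ≤ N → 0 ≤ (k : ℝ) * d ∧ (k : ℝ) * d ≤ 7 / 2 := by
    intro k hk
    refine ⟨by positivity, ?_⟩
    rw [← hNd]; gcongr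
  have hkb : ∀ k : ℕ, k ≤ N → ∀ z ∈ ball (c - k * d) (4 * r), z ∈ U := by
    intro k hk z hz
    exact (hball (k * d) (hkd k hk).1 (hkd k hk).2 z (by push_cast; exact hz)).1
  have hfin := hch (fun z => f z / (L : ℂ)) c d hd0 hdr
    (fun k hk => (hfd.mono (hkb k hk)).div_const _)
    (fun k hk z hz => by
      rw [Complex.div_ofReal_re, div_le_iff₀ hL0]
      exact hU5 z (hkb k hk z hz))
    (fun z hz => by
      rw [norm_div, Complex.norm_real, Real.norm_eq_abs, abs_of_pos hL0, div_le_iff₀ hL0]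
      refine (hstart z hz).trans ?_
      rw [div_le_iff₀ hκ] at hLκ
      linarith)
    (c - N * d) (by simp [hr.le])
  have hp : c - N * d = -1 + τ * I := by
    have : ((N : ℂ) * d) = ((N * d : ℝ) : ℂ) := by push_cast; ring
    rw [this, hNd, hc]; push_cast; ring
  rw [hp] at hfin
  have hpU : (-1 + τ * I : ℂ) ∈ U := by
    rw [hmem]; simp [hR]; norm_num
  have h1 : L ≤ (f (-1 + τ * I)).re := by
    rw [hfre _ hpU, hL]
    exact Real.log_le_log hτ0 (zz_lower τ hτ1)
  rw [norm_div, Complex.norm_real, Real.norm_eq_abs, abs_of_pos hL0, div_le_iff₀ hL0] at hfin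
  have := Complex.re_le_norm (f (-1 + τ * I))
  linarith

lemma zz_final (hRH : RiemannHypothesis) (δ : ℝ) (hδ : 0 < δ) :
    ∃ T₀ : ℝ, 0 < T₀ ∧ ∀ T : ℝ, T₀ ≤ T → ∃ t ∈ Set.Icc T (T + δ),
      riemannZeta (1 / 2 + Complex.I * t) = 0 := by
  obtain ⟨R, hR, hR1, hRδ⟩ : ∃ R : ℝ, 0 < R ∧ R ≤ 1 / 2 ∧ 2 * R ≤ δ := by
    refine ⟨min δ 1 / 2, by positivity, ?_, ?_⟩
    · linarith [min_le_right δ 1]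
    · linarith [min_le_left δ 1]
  obtain ⟨T₀, hT0, h⟩ := zz_core R hR hR1
  refine ⟨T₀, by linarith, fun T hT => ?_⟩
  obtain ⟨s, hs, hz⟩ := h (T + R) (by linarith)
  rw [abs_lt] at hs
  have him : 0 < s.im := by linarith [hs.1]
  have hre := hRH s hz
    (by rintro ⟨n, rfl⟩; simp at him)
    (by rintro rfl; simp at him)
  refine ⟨s.im, ⟨by linarith [hs.1], by linarith [hs.2]⟩, ?_⟩
  have : (1 / 2 + Complex.I * s.im : ℂ) = s := by
    apply Complex.ext
    · simp [hre]
    · simp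
  rw [this, hz]

end Helpers

/-- Assuming the Riemann hypothesis, for every `δ > 0` there is `T₀ > 0`
such that every interval `[T, T+δ]` with `T ≥ T₀` contains a `t` with
`ζ(1/2 + it) = 0`. -/
theorem zero_in_every_high_interval_of_RH
    (hRH : RiemannHypothesis) (δ : ℝ) (hδ : 0 < δ) :
    ∃ T₀ : ℝ, 0 < T₀ ∧ ∀ T : ℝ, T₀ ≤ T → ∃ t ∈ Set.Icc T (T + δ),
      riemannZeta (1 / 2 + Complex.I * t) = 0 := by
  exact zz_final hRH δ hδ
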